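/- Let ν ∈ ℕ and let f_i, g_i, i = 1,…,ν, be even real functions on 𝕋 = (−π,π] such that each g_i belongs to F₁(𝕋) := { f ∈ L¹(𝕋) : ∑_{k∈ℤ} |k| |f̂(k)| < ∞ } and each f_i belongs to the ARMA class F₂(𝕋), i.e. f_i(λ) = (σ_i²/2π)·|A_i(e^{iλ})/B_i(e^{iλ})|² with 0 < σ_i² < ∞ and polynomials A_i(z) = ∑_{k=0}^{q_i} a_{ik} z^k and B_i(z) = ∑_{k=0}^{p_i} b_{ik} z^k whose moduli are bounded away from zero on the closed disc |z| ≤ 1. Then the matrices B_T(f_i) are invertible for all T and | (1/T)·tr[∏_{i=1}^{ν} B_T(f_i)^{-1} B_T(g_i)] − (1/2π) ∫_{−π}^{π} ∏_{i=1}^{ν} (g_i(λ)/f_i(λ)) dλ | = O(T^{−1}) as T → ∞. -/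

import Mathlib

open MeasureTheory Filter Set Asymptotics Real
open scoped ENNReal Topology

noncomputable section

/-- Fourier coefficient on the torus. -/
def fcT (h : ℝ → ℝ) (t : ℤ) : ℂ :=
  ∫ x in Ioc (-π) π, Complex.exp (Complex.I * x * t) * (h x)

/-- T × T Toeplitz matrix. -/
def BT (n : ℕ) (h : ℝ → ℝ) : Matrix (Fin n) (Fin n) ℂ :=
  fun s t => fcT h ((s : ℤ) - (t : ℤ))

/-- The class F₁(𝕋) of integrable functions with ∑ |k|·|f̂(k)| < ∞. -/
def memF1T (h : ℝ → ℝ) : Prop :=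
  IntegrableOn h (Ioc (-π) π) ∧ Summable (fun k : ℤ => (|k| : ℝ) * ‖fcT h k‖)

/-- The ARMA class F₂(𝕋): rational spectral densities
f(λ) = (σ²/2π)·|A(e^{iλ})/B(e^{iλ})|² with A, B polynomials bounded
away from zero on the closed unit disc. -/
def memF2T (f : ℝ → ℝ) : Prop :=
  ∃ (σ2 : ℝ) (A B : Polynomial ℂ), 0 < σ2 ∧
    (∃ c > (0 : ℝ), ∀ z : ℂ, ‖z‖ ≤ 1 → c ≤ ‖A.eval z‖) ∧
    (∃ c > (0 : ℝ), ∀ z : ℂ, ‖z‖ ≤ 1 → c ≤ ‖B.eval z‖) ∧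
    ∀ x : ℝ, f x = σ2 / (2 * π) *
      ‖A.eval (Complex.exp (Complex.I * x)) / B.eval (Complex.exp (Complex.I * x))‖ ^ 2


theorem integral_exp_int (m : ℤ) :
    ∫ x in Ioc (-π) π, Complex.exp (Complex.I * x * m) = if m = 0 then (2 * π : ℂ) else 0 := by
  rw [← intervalIntegral.integral_of_le (by linarith [pi_pos])]
  split_ifs with h
  · subst h
    simp
    ring
  · have hc : Complex.I * m ≠ 0 := by simp [h]
    have := integral_exp_mul_complex (a := -π) (b := π) hc
    have h2 : ∀ x : ℝ, Complex.I * x * m = Complex.I * m * x := fun x => by ring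
    simp_rw [h2]
    rw [this]
    have h3 : Complex.exp (Complex.I * m * (π : ℝ)) = Complex.exp (Complex.I * m * (-π : ℝ)) := by
      rw [Complex.exp_eq_exp_iff_exists_int]
      refine ⟨m, ?_⟩
      push_cast
      ring
    rw [h3]; simp

theorem ae_zero_of_coeff (D : ℝ → ℂ) (hD : IntegrableOn D (Ioc (-π) π))
    (h : ∀ k : ℤ, ∫ x in Ioc (-π) π, Complex.exp (Complex.I * x * k) * D x = 0) :
    ∀ᵐ x ∂(volume.restrict (Ioc (-π) π)), D x = 0 := by
  have : Fact (0 < 2 * π) := ⟨by positivity⟩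
  have hint : ∀ φ : C(AddCircle (2 * π), ℂ),
      IntegrableOn (fun x : ℝ => φ (x : AddCircle (2 * π)) * D x) (Ioc (-π) π) := by
    intro φ
    refine Integrable.bdd_mul (c := ‖φ‖) hD ?_ ?_
    · exact (φ.continuous.comp (AddCircle.continuous_mk' _)).aestronglyMeasurable
    · exact ae_of_all _ (fun x => φ.norm_coe_le_norm _)
  let L : C(AddCircle (2 * π), ℂ) →ₗ[ℂ] ℂ :=
    { toFun := fun φ => ∫ x in Ioc (-π) π, φ (x : AddCircle (2 * π)) * D x
      map_add' := by
        intro φ ψ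
        rw [← integral_add (hint φ) (hint ψ)]
        simp [add_mul]
      map_smul' := by
        intro c φ
        simp [mul_assoc, integral_const_mul] }
  let L' : C(AddCircle (2 * π), ℂ) →L[ℂ] ℂ :=
    L.mkContinuous (∫ x in Ioc (-π) π, ‖D x‖) (by
      intro φ
      show ‖∫ x in Ioc (-π) π, φ (x : AddCircle (2 * π)) * D x‖ ≤ _
      rw [mul_comm (∫ x in Ioc (-π) π, ‖D x‖), ← integral_const_mul]
      refine norm_integral_le_of_norm_le (hD.norm.const_mul _) (ae_of_all _ fun x => ?_)
      rw [norm_mul]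
      gcongr
      exact φ.norm_coe_le_norm _)
  have hker : ∀ φ : C(AddCircle (2 * π), ℂ), L' φ = 0 := by
    intro φ
    have h1 : (Submodule.span ℂ (range <| @fourier (2 * π))) ≤ LinearMap.ker L'.toLinearMap := by
      rw [Submodule.span_le]
      rintro _ ⟨k, rfl⟩
      show ∫ x in Ioc (-π) π, fourier k (x : AddCircle (2 * π)) * D x = 0
      rw [← h k]
      refine integral_congr_ae (ae_of_all _ fun x => ?_)
      simp only [fourier_coe_apply]
      congr 2
      have : (π : ℂ) ≠ 0 := by exact_mod_cast pi_ne_zero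
      push_cast
      field_simp
    have h2 : (Submodule.span ℂ (range <| @fourier (2 * π))).topologicalClosure
        ≤ LinearMap.ker L'.toLinearMap :=
      Submodule.topologicalClosure_minimal _ h1 L'.isClosed_ker
    rw [span_fourier_closure_eq_top] at h2
    exact h2 (Submodule.mem_top (x := φ))
  have key : ∀ᵐ x ∂(volume : Measure ℝ), x ∈ Ioo (-π) π → D x = 0 := by
    refine IsOpen.ae_eq_zero_of_integral_contDiff_smul_eq_zero isOpen_Ioo
      (hD.mono_set Ioo_subset_Ioc_self).locallyIntegrableOn ?_
    intro φ hφ hc hs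
    have hz : ∀ x, x ∉ Ioo (-π) π → φ x = 0 := fun x hx =>
      image_eq_zero_of_notMem_tsupport (fun h => hx (hs h))
    let ψ : ℝ → ℂ := fun x => (φ x : ℂ)
    have hψ : Continuous (AddCircle.liftIoc (2 * π) (-π) ψ) := by
      refine AddCircle.liftIoc_continuous ?_ ?_
      · simp only [ψ]; rw [hz _ (by simp), hz _ (by simp; intro; linarith)]
      · exact (Complex.continuous_ofReal.comp hφ.continuous).continuousOn
    have h3 := hker ⟨_, hψ⟩
    change ∫ x in Ioc (-π) π, (AddCircle.liftIoc (2 * π) (-π) ψ) (x : AddCircle (2 * π)) * D x = 0 at h3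
    rw [← h3, ← setIntegral_eq_integral_of_forall_compl_eq_zero (s := Ioc (-π) π)]
    · refine setIntegral_congr_fun measurableSet_Ioc fun x hx => ?_
      rw [AddCircle.liftIoc_coe_apply ⟨hx.1, by linarith [hx.2]⟩]
      simp [ψ]
    · intro x hx
      rw [hz x (fun h => hx (Ioo_subset_Ioc_self h))]; simp
  rw [← restrict_Ioo_eq_restrict_Ioc]
  rw [ae_restrict_iff' measurableSet_Ioo]
  exact key

/-- Fourier series with coefficients `a`. -/
def FS (a : ℤ → ℂ) (x : ℝ) : ℂ := ∑' k : ℤ, a k * Complex.exp (-(Complex.I * x * k))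

theorem norm_exp_I (x : ℝ) (k : ℤ) : ‖Complex.exp (-(Complex.I * x * k))‖ = 1 := by
  have : -(Complex.I * x * k) = ((-(x * k) : ℝ) : ℂ) * Complex.I := by push_cast; ring
  rw [this, Complex.norm_exp_ofReal_mul_I]

theorem norm_exp_I' (x : ℝ) (k : ℤ) : ‖Complex.exp ((Complex.I * x * k))‖ = 1 := by
  have : (Complex.I * x * k) = (((x * k) : ℝ) : ℂ) * Complex.I := by push_cast; ring
  rw [this, Complex.norm_exp_ofReal_mul_I]

theorem FS_continuous {a : ℤ → ℂ} (ha : Summable fun k => ‖a k‖) : Continuous (FS a) := by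
  refine continuous_tsum (fun k => by fun_prop) ha (fun k x => ?_)
  rw [norm_mul, norm_exp_I, mul_one]

theorem FS_coeff {a : ℤ → ℂ} (ha : Summable fun k => ‖a k‖) (m : ℤ) :
    ∫ x in Ioc (-π) π, Complex.exp (Complex.I * x * m) * FS a x = 2 * π * a m := by
  have hF : ∀ k, Integrable (fun x : ℝ => Complex.exp (Complex.I * x * m) *
      (a k * Complex.exp (-(Complex.I * x * k)))) (volume.restrict (Ioc (-π) π)) := by
    intro k
    refine (Continuous.integrableOn_Icc (a := -π) (b := π) (by fun_prop)).mono_set Ioc_subset_Icc_self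
  have h1 := integral_tsum_of_summable_integral_norm hF (by
    simp_rw [norm_mul, norm_exp_I, norm_exp_I']
    simp only [mul_one, one_mul]
    simp only [integral_const]
    exact ha.const_smul _)
  have h2 : ∀ k, ∫ x in Ioc (-π) π, Complex.exp (Complex.I * x * m) *
      (a k * Complex.exp (-(Complex.I * x * k))) = if k = m then 2 * π * a m else 0 := by
    intro k
    have : ∀ x : ℝ, Complex.exp (Complex.I * x * m) * (a k * Complex.exp (-(Complex.I * x * k)))
        = a k * Complex.exp (Complex.I * x * ((m - k : ℤ) : ℂ)) := by
      intro x
      rw [mul_left_comm, ← Complex.exp_add]; congr 2; push_cast; ring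
    simp_rw [this]
    rw [integral_const_mul, integral_exp_int]
    by_cases hk : k = m
    · subst hk; simp; ring
    · rw [if_neg (by omega), if_neg hk, mul_zero]
  simp_rw [h2] at h1
  rw [tsum_ite_eq] at h1
  rw [h1]
  refine integral_congr_ae (ae_of_all _ fun x => ?_)
  simp only [FS]
  rw [tsum_mul_left]

/-- `h` has the Fourier series `a`, with a weighted summability. -/
def FRep (a : ℤ → ℂ) (h : ℝ → ℂ) : Prop :=
  Summable (fun k : ℤ => (1 + |(k : ℝ)|) * ‖a k‖) ∧
    ∀ᵐ x ∂(volume.restrict (Ioc (-π) π)), h x = FS a x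

theorem summable_of_w {a : ℤ → ℂ} (h : Summable (fun k : ℤ => (1 + |(k : ℝ)|) * ‖a k‖)) :
    Summable fun k => ‖a k‖ := by
  refine Summable.of_nonneg_of_le (fun _ => norm_nonneg _) (fun k => ?_) h
  have := abs_nonneg (k : ℝ)
  nlinarith [norm_nonneg (a k)]

theorem summable_of_w' {a : ℤ → ℂ} (h : Summable (fun k : ℤ => (1 + |(k : ℝ)|) * ‖a k‖)) :
    Summable fun k : ℤ => |(k : ℝ)| * ‖a k‖ := by
  refine Summable.of_nonneg_of_le (fun _ => by positivity) (fun k => ?_) h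
  nlinarith [norm_nonneg (a k)]

theorem FRep.coeff {a h} (H : FRep a h) (m : ℤ) :
    ∫ x in Ioc (-π) π, Complex.exp (Complex.I * x * m) * h x = 2 * π * a m := by
  rw [← FS_coeff (summable_of_w H.1) m]
  refine integral_congr_ae ?_
  filter_upwards [H.2] with x hx
  rw [hx]

theorem FRep.coeff_zero {a h} (H : FRep a h) :
    ∫ x in Ioc (-π) π, h x = 2 * π * a 0 := by
  simpa using H.coeff 0

theorem summable_w_of {a : ℤ → ℂ} (h : Summable fun k : ℤ => |(k : ℝ)| * ‖a k‖) :
    Summable (fun k : ℤ => (1 + |(k : ℝ)|) * ‖a k‖) := by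
  have h1 : Summable fun k => ‖a k‖ := by
    refine Summable.of_norm_bounded_eventually h ?_
    refine (Set.finite_singleton (0 : ℤ)).subset ?_
    intro k hk
    by_contra hk0
    apply hk
    have : (1 : ℝ) ≤ |(k : ℝ)| := by
      have : 1 ≤ |k| := Int.one_le_abs hk0
      exact_mod_cast this
    show ‖‖a k‖‖ ≤ |(k : ℝ)| * ‖a k‖
    rw [norm_norm]
    nlinarith [norm_nonneg (a k)]
  simp_rw [add_mul, one_mul]
  exact h1.add h

theorem FRep.of_memF1T {g : ℝ → ℝ} (hg : memF1T g) : FRep (fcT g) (fun x => 2 * π * g x) := by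
  have hs := summable_w_of (a := fcT g) (by simpa using hg.2)
  have hs1 := summable_of_w hs
  refine ⟨hs, ?_⟩
  have hgi : IntegrableOn (fun x => (2 * π * g x : ℂ)) (Ioc (-π) π) := (hg.1.ofReal).const_mul _
  have hFi : IntegrableOn (FS (fcT g)) (Ioc (-π) π) :=
    ((FS_continuous hs1).integrableOn_Icc (a := -π) (b := π)).mono_set Ioc_subset_Icc_self
  have hex : ∀ (k : ℤ) (u : ℝ → ℂ), IntegrableOn u (Ioc (-π) π) →
      IntegrableOn (fun x : ℝ => Complex.exp (Complex.I * x * k) * u x) (Ioc (-π) π) := by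
    intro k u hu
    refine Integrable.bdd_mul (c := 1) hu ?_ ?_
    · exact Continuous.aestronglyMeasurable (by fun_prop)
    · exact ae_of_all _ (fun x => (norm_exp_I' x k).le)
  have := ae_zero_of_coeff (fun x => 2 * π * g x - FS (fcT g) x) (hgi.sub hFi) (by
    intro k
    simp_rw [mul_sub]
    rw [integral_sub (hex k _ hgi) (hex k _ hFi), FS_coeff hs1, sub_eq_zero, fcT, ← integral_const_mul]
    refine integral_congr_ae (ae_of_all _ fun x => ?_)
    simp only
    ring)
  filter_upwards [this] with x hx
  exact sub_eq_zero.mp hx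

/-- Convolution. -/
def cv (a b : ℤ → ℂ) (k : ℤ) : ℂ := ∑' j : ℤ, a (k - j) * b j

/-- Shear equivalence. -/
def shearE : ℤ × ℤ ≃ ℤ × ℤ where
  toFun p := (p.1 - p.2, p.2)
  invFun p := (p.1 + p.2, p.2)
  left_inv p := by simp
  right_inv p := by simp

theorem summable_shear {u v : ℤ → ℝ} (hu : Summable u) (hv : Summable v)
    (hu0 : ∀ k, 0 ≤ u k) (hv0 : ∀ k, 0 ≤ v k) :
    Summable fun p : ℤ × ℤ => u (p.1 - p.2) * v p.2 := by
  have := hu.mul_of_nonneg hv hu0 hv0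
  exact (shearE.summable_iff (f := fun p : ℤ × ℤ => u p.1 * v p.2)).mpr this

theorem FRep.mul {a b h k} (ha : FRep a h) (hb : FRep b k) : FRep (cv a b) (fun x => h x * k x) := by
  have hsa := summable_of_w ha.1
  have hsb := summable_of_w hb.1
  constructor
  · have hW := summable_shear ha.1 hb.1 (fun _ => by positivity) (fun _ => by positivity)
    refine Summable.of_nonneg_of_le (fun _ => by positivity) (fun m => ?_) hW.prod
    have hsm : Summable fun j : ℤ => ‖a (m - j) * b j‖ := by
      simpa using (summable_shear hsa hsb (fun _ => norm_nonneg _) (fun _ => norm_nonneg _)).prod_factor m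
    calc (1 + |(m : ℝ)|) * ‖cv a b m‖ ≤ (1 + |(m : ℝ)|) * ∑' j, ‖a (m - j) * b j‖ := by
          gcongr
          exact norm_tsum_le_tsum_norm hsm
      _ = ∑' j, (1 + |(m : ℝ)|) * ‖a (m - j) * b j‖ := by rw [tsum_mul_left]
      _ ≤ _ := by
          refine Summable.tsum_le_tsum (fun j => ?_) (hsm.mul_left _) (hW.prod_factor m)
          simp only [norm_mul]
          have h1 : |(m : ℝ)| ≤ |((m - j : ℤ) : ℝ)| + |(j : ℝ)| := by
            have := abs_add_le ((m - j : ℤ) : ℝ) (j : ℝ)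
            simpa using this
          have h2 : 1 + |(m : ℝ)| ≤ (1 + |((m - j : ℤ) : ℝ)|) * (1 + |(j : ℝ)|) := by
            nlinarith [abs_nonneg ((m - j : ℤ) : ℝ), abs_nonneg (j : ℝ),
              mul_nonneg (abs_nonneg ((m - j : ℤ) : ℝ)) (abs_nonneg (j : ℝ))]
          calc _ ≤ (1 + |((m - j : ℤ) : ℝ)|) * (1 + |(j : ℝ)|) * (‖a (m - j)‖ * ‖b j‖) := by gcongr
            _ = _ := by ring
  · filter_upwards [ha.2, hb.2] with x hx hy
    rw [hx, hy]
    have hu : Summable fun k : ℤ => ‖a k * Complex.exp (-(Complex.I * x * k))‖ := by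
      simpa [norm_mul, norm_exp_I] using hsa
    have hv : Summable fun k : ℤ => ‖b k * Complex.exp (-(Complex.I * x * k))‖ := by
      simpa [norm_mul, norm_exp_I] using hsb
    unfold FS
    rw [tsum_mul_tsum_of_summable_norm hu hv]
    rw [← shearE.tsum_eq]
    have hS : Summable fun p : ℤ × ℤ => (a (p.1 - p.2) * Complex.exp (-(Complex.I * x * (p.1 - p.2 : ℤ)))) *
        (b p.2 * Complex.exp (-(Complex.I * x * p.2))) := by
      have h0 := summable_mul_of_summable_norm hu hv
      exact (shearE.summable_iff (f := fun p : ℤ × ℤ => (a p.1 * Complex.exp (-(Complex.I * x * p.1))) *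
        (b p.2 * Complex.exp (-(Complex.I * x * p.2))))).mpr h0
    refine (hS.tsum_prod).trans ?_
    refine tsum_congr fun m => ?_
    unfold cv
    rw [← tsum_mul_right]
    refine tsum_congr fun j => ?_
    have : Complex.exp (-(Complex.I * x * m)) = Complex.exp (-(Complex.I * x * (m - j : ℤ))) *
        Complex.exp (-(Complex.I * x * j)) := by
      rw [← Complex.exp_add]; congr 1; push_cast; ring
    simp only
    rw [this]; ring

/-- Coefficients of the constant 1. -/
def dl (k : ℤ) : ℂ := if k = 0 then 1 else 0

theorem FRep.one : FRep dl (fun _ => 1) := by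
  constructor
  · refine summable_of_ne_finset_zero (s := {0}) ?_
    intro k hk
    simp at hk
    simp [dl, hk]
  · refine ae_of_all _ fun x => ?_
    unfold FS
    rw [tsum_eq_single 0]
    · simp [dl]
    · intro k hk
      simp [dl, hk]

theorem FRep.unique {a b h k} (ha : FRep a h) (hb : FRep b k)
    (hk : ∀ᵐ x ∂(volume.restrict (Ioc (-π) π)), h x = k x) : a = b := by
  funext m
  have h1 := ha.coeff m
  have h2 := hb.coeff m
  have h3 : ∫ x in Ioc (-π) π, Complex.exp (Complex.I * x * m) * h x =
      ∫ x in Ioc (-π) π, Complex.exp (Complex.I * x * m) * k x := by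
    refine integral_congr_ae ?_
    filter_upwards [hk] with x hx
    rw [hx]
  rw [h1, h2] at h3
  have : (2 * π : ℂ) ≠ 0 := by simp [pi_ne_zero]
  exact mul_left_cancel₀ this h3

theorem FRep.smul {a h} (H : FRep a h) (c : ℂ) : FRep (fun k => c * a k) (fun x => c * h x) := by
  constructor
  · refine (H.1.mul_left ‖c‖).congr fun k => ?_
    rw [norm_mul]; ring
  · filter_upwards [H.2] with x hx
    rw [hx]
    unfold FS
    rw [← tsum_mul_left]
    exact tsum_congr fun k => by ring

theorem fcT_deriv (u : ℝ → ℝ) (hu : ContDiff ℝ 1 u) (hp : Function.Periodic u (2 * π)) (k : ℤ) :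
    fcT (deriv u) k = -(Complex.I * k) * fcT u k := by
  unfold fcT
  rw [← intervalIntegral.integral_of_le (by linarith [pi_pos]),
    ← intervalIntegral.integral_of_le (by linarith [pi_pos])]
  have hd : ∀ x, HasDerivAt (fun x : ℝ => (u x : ℂ)) ((deriv u x : ℝ) : ℂ) x := fun x =>
    ((hu.differentiable (by norm_num)) x).hasDerivAt.ofReal_comp
  have he : ∀ x : ℝ, HasDerivAt (fun x : ℝ => Complex.exp (Complex.I * x * k))
      (Complex.exp (Complex.I * x * k) * (Complex.I * k)) x := by
    intro x
    have h1 : HasDerivAt (fun x : ℝ => (Complex.I * x * k)) (Complex.I * k) x := by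
      have := ((Complex.ofRealCLM.hasDerivAt (x := x)).const_mul Complex.I).mul_const (k : ℂ)
      simpa using this
    exact h1.cexp
  rw [intervalIntegral.integral_mul_deriv_eq_deriv_mul (fun x _ => he x) (fun x _ => hd x)]
  · have h3 : Complex.exp (Complex.I * (π : ℝ) * k) = Complex.exp (Complex.I * (-π : ℝ) * k) := by
      rw [Complex.exp_eq_exp_iff_exists_int]
      refine ⟨k, ?_⟩
      push_cast
      ring
    have h4 : u π = u (-π) := by
      rw [← hp (-π)]; congr 1; ring
    rw [h3, h4, sub_self, zero_sub, ← intervalIntegral.integral_const_mul, ← intervalIntegral.integral_neg]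
    refine intervalIntegral.integral_congr fun x _ => ?_
    ring
  · exact Continuous.intervalIntegrable (by fun_prop) _ _
  · have := hu.continuous_deriv (by norm_num)
    exact Continuous.intervalIntegrable (by fun_prop) _ _

theorem periodic_deriv {u : ℝ → ℝ} (hp : Function.Periodic u (2 * π)) :
    Function.Periodic (deriv u) (2 * π) := by
  intro x
  rw [← deriv_comp_add_const]
  congr 1
  funext y
  exact hp y

theorem norm_fcT_le (u : ℝ → ℝ) (k : ℤ) : ‖fcT u k‖ ≤ ∫ x in Ioc (-π) π, |u x| := by
  unfold fcT
  refine (norm_integral_le_integral_norm _).trans (le_of_eq ?_)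
  refine integral_congr_ae (ae_of_all _ fun x => ?_)
  simp only [norm_mul, norm_exp_I', one_mul, Complex.norm_real, Real.norm_eq_abs]

theorem memF1T_of_smooth (u : ℝ → ℝ) (hu : ContDiff ℝ 3 u) (hp : Function.Periodic u (2 * π)) :
    memF1T u := by
  refine ⟨(hu.continuous.integrableOn_Icc (a := -π) (b := π)).mono_set Ioc_subset_Icc_self, ?_⟩
  have h1 : ContDiff ℝ 2 (deriv u) := by
    have : ContDiff ℝ (2 + 1) u := by convert hu using 1; norm_num
    exact (contDiff_succ_iff_deriv.mp this).2.2
  have h2 : ContDiff ℝ 1 (deriv (deriv u)) := by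
    have : ContDiff ℝ (1 + 1) (deriv u) := by convert h1 using 1; norm_num
    exact (contDiff_succ_iff_deriv.mp this).2.2
  set C := ∫ x in Ioc (-π) π, |deriv (deriv (deriv u)) x| with hC
  have hb : ∀ k : ℤ, |(k : ℝ)| ^ 3 * ‖fcT u k‖ ≤ C := by
    intro k
    have := norm_fcT_le (deriv (deriv (deriv u))) k
    rw [fcT_deriv _ h2 (periodic_deriv (periodic_deriv hp)), fcT_deriv _ (h1.of_le (by norm_num)) (periodic_deriv hp),
      fcT_deriv _ (hu.of_le (by norm_num)) hp] at this
    simp only [norm_mul, norm_neg, Complex.norm_I, one_mul, Complex.norm_intCast] at this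
    calc _ = |(k : ℝ)| * (|(k : ℝ)| * (|(k : ℝ)| * ‖fcT u k‖)) := by ring
      _ ≤ C := this
  have hs : Summable fun k : ℤ => C * (1 / (k : ℝ) ^ 2) :=
    (Real.summable_one_div_int_pow.mpr (by norm_num)).mul_left C
  refine Summable.of_nonneg_of_le (fun _ => by positivity) (fun k => ?_) hs
  by_cases hk : k = 0
  · subst hk; simp
  · have hk' : 0 < |(k : ℝ)| := by simpa using hk
    rw [mul_one_div, le_div_iff₀ (by rw [← sq_abs]; positivity), ← sq_abs]
    calc _ = |(k : ℝ)| ^ 3 * ‖fcT u k‖ := by ring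
      _ ≤ C := hb k

theorem memF2T.smooth {f : ℝ → ℝ} (hf : memF2T f) : ContDiff ℝ 3 f := by
  obtain ⟨σ2, A, B, hσ, ⟨cA, hcA, hA⟩, ⟨cB, hcB, hB⟩, hfx⟩ := hf
  have hn : ∀ x : ℝ, ‖Complex.exp (Complex.I * x)‖ = 1 := by
    intro x; rw [mul_comm, Complex.norm_exp_ofReal_mul_I]
  have he : ContDiff ℝ 3 (fun x : ℝ => Complex.exp (Complex.I * x)) := by
    have : ContDiff ℝ 3 (fun x : ℝ => (x : ℂ)) := Complex.ofRealCLM.contDiff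
    exact (contDiff_const.mul this).cexp
  have hP : ∀ P : Polynomial ℂ, ContDiff ℝ 3 (fun x : ℝ => P.eval (Complex.exp (Complex.I * x))) := by
    intro P
    have h1 : ContDiff ℂ 3 (fun z : ℂ => P.eval z) := by
      simpa using P.contDiff_aeval (𝕜 := ℂ) (n := 3)
    exact (h1.restrict_scalars ℝ).comp he
  have : f = fun x : ℝ => σ2 / (2 * π) *
      ‖A.eval (Complex.exp (Complex.I * x)) / B.eval (Complex.exp (Complex.I * x))‖ ^ 2 := funext hfx
  rw [this]
  have hdiv : ContDiff ℝ 3 (fun x : ℝ => A.eval (Complex.exp (Complex.I * x)) /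
      B.eval (Complex.exp (Complex.I * x))) := by
    simp_rw [div_eq_mul_inv]
    refine (hP A).mul ((hP B).inv fun x h0 => ?_)
    have := hB _ (hn x).le
    rw [h0, norm_zero] at this
    linarith
  exact contDiff_const.mul (hdiv.norm_sq ℝ)

theorem memF2T.periodic {f : ℝ → ℝ} (hf : memF2T f) : Function.Periodic f (2 * π) := by
  obtain ⟨σ2, A, B, hσ, -, -, hfx⟩ := hf
  intro x
  have : Complex.exp (Complex.I * (x + 2 * π : ℝ)) = Complex.exp (Complex.I * x) := by
    rw [Complex.exp_eq_exp_iff_exists_int]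
    exact ⟨1, by push_cast; ring⟩
  rw [hfx, hfx, this]

theorem memF2T.memF1T {f : ℝ → ℝ} (hf : memF2T f) : memF1T f :=
  memF1T_of_smooth f hf.smooth hf.periodic

theorem memF2T.pos {f : ℝ → ℝ} (hf : memF2T f) (x : ℝ) : 0 < f x := by
  obtain ⟨σ2, A, B, hσ, ⟨cA, hcA, hA⟩, ⟨cB, hcB, hB⟩, hfx⟩ := hf
  have hn : ‖Complex.exp (Complex.I * x)‖ = 1 := by
    rw [mul_comm, Complex.norm_exp_ofReal_mul_I]
  rw [hfx, norm_div]
  have h1 := hcA.trans_le (hA _ hn.le)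
  have h2 := hcB.trans_le (hB _ hn.le)
  have := pi_pos
  positivity

theorem memF2T.inv {f : ℝ → ℝ} (hf : memF2T f) : memF2T (fun x => (f x)⁻¹) := by
  obtain ⟨σ2, A, B, hσ, hA, hB, hfx⟩ := hf
  refine ⟨(2 * π) ^ 2 / σ2, B, A, by positivity, hB, hA, fun x => ?_⟩
  simp only
  rw [hfx, mul_inv, norm_div, norm_div, div_pow, div_pow, inv_div, inv_div]
  congr 1
  have := pi_pos
  field_simp

theorem memF2T.lower {f : ℝ → ℝ} (hf : memF2T f) : ∃ m > 0, ∀ x ∈ Icc (-π) π, m ≤ f x := by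
  obtain ⟨x0, _, hx0⟩ := isCompact_Icc.exists_isMinOn (α := ℝ) (β := ℝ) (s := Icc (-π) π) (f := f)
    ⟨0, by simp [pi_pos.le]⟩ hf.smooth.continuous.continuousOn
  exact ⟨f x0, hf.pos x0, fun x hx => hx0 hx⟩

section mats

open scoped Matrix.Norms.L2Operator

theorem opNorm_le_of {n : ℕ} (M : Matrix (Fin n) (Fin n) ℂ) (C : ℝ) (hC : 0 ≤ C)
    (h : ∀ x : EuclideanSpace ℂ (Fin n), ‖WithLp.toLp 2 (M.mulVec x.ofLp)‖ ≤ C * ‖x‖) : ‖M‖ ≤ C := by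
  rw [Matrix.l2_opNorm_def]
  exact ContinuousLinearMap.opNorm_le_bound _ hC h

theorem le_opNorm_mulVec {n : ℕ} (M : Matrix (Fin n) (Fin n) ℂ) (x : EuclideanSpace ℂ (Fin n)) :
    ‖WithLp.toLp 2 (M.mulVec x.ofLp)‖ ≤ ‖M‖ * ‖x‖ := Matrix.l2_opNorm_mulVec M x

theorem entry_le_opNorm {n : ℕ} (M : Matrix (Fin n) (Fin n) ℂ) (i j : Fin n) : ‖M i j‖ ≤ ‖M‖ := by
  have h := le_opNorm_mulVec M (EuclideanSpace.single j 1)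
  have h2 := PiLp.norm_apply_le (WithLp.toLp 2 (M.mulVec (EuclideanSpace.single j (1 : ℂ)).ofLp)) i
  simp at h h2
  exact h2.trans h

theorem norm_one_le {n : ℕ} : ‖(1 : Matrix (Fin n) (Fin n) ℂ)‖ ≤ 1 :=
  opNorm_le_of _ 1 zero_le_one (fun x => by simp)

theorem trace_mul_le {n : ℕ} (E X : Matrix (Fin n) (Fin n) ℂ) :
    ‖(E * X).trace‖ ≤ (∑ s, ∑ t, ‖E s t‖) * ‖X‖ := by
  simp only [Matrix.trace, Matrix.diag, Matrix.mul_apply]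
  rw [Finset.sum_mul]
  refine norm_sum_le_of_le _ fun s _ => ?_
  rw [Finset.sum_mul]
  refine norm_sum_le_of_le _ fun t _ => ?_
  rw [norm_mul]
  gcongr
  exact entry_le_opNorm _ _ _

/-- Toeplitz matrix of a sequence. -/
def Toep (n : ℕ) (a : ℤ → ℂ) : Matrix (Fin n) (Fin n) ℂ := fun s t => a ((s : ℤ) - (t : ℤ))

theorem schur {n : ℕ} (M : Matrix (Fin n) (Fin n) ℂ) (C : ℝ) (hC : 0 ≤ C)
    (hr : ∀ s, ∑ t, ‖M s t‖ ≤ C) (hc : ∀ t, ∑ s, ‖M s t‖ ≤ C) : ‖M‖ ≤ C := by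
  refine opNorm_le_of M C hC fun x => ?_
  refine le_of_sq_le_sq ?_ (by positivity)
  rw [mul_pow, EuclideanSpace.norm_sq_eq, EuclideanSpace.norm_sq_eq]
  calc ∑ s, ‖(WithLp.toLp 2 (M.mulVec x.ofLp)) s‖ ^ 2
      ≤ ∑ s, C * ∑ t, ‖M s t‖ * ‖x t‖ ^ 2 := by
        refine Finset.sum_le_sum fun s _ => ?_
        have h1 : ‖(WithLp.toLp 2 (M.mulVec x.ofLp)) s‖ ≤ ∑ t, ‖M s t‖ * ‖x t‖ := by
          simp only [Matrix.mulVec, dotProduct]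
          refine norm_sum_le_of_le _ fun t _ => ?_
          rw [norm_mul]
        have h2 : (∑ t, ‖M s t‖ * ‖x t‖) ^ 2 ≤ (∑ t, ‖M s t‖) * ∑ t, ‖M s t‖ * ‖x t‖ ^ 2 := by
          refine Finset.sum_sq_le_sum_mul_sum_of_sq_le_mul _ (fun _ _ => by positivity)
            (fun _ _ => by positivity) (fun _ _ => le_of_eq (by ring))
        calc _ ≤ (∑ t, ‖M s t‖ * ‖x t‖) ^ 2 := by gcongr
          _ ≤ _ := h2
          _ ≤ _ := by
            gcongr
            exact hr s
    _ = C * ∑ t, (∑ s, ‖M s t‖) * ‖x t‖ ^ 2 := by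
        rw [← Finset.mul_sum, Finset.sum_comm]
        simp_rw [Finset.sum_mul]
    _ ≤ C * ∑ t, C * ‖x t‖ ^ 2 := by
        gcongr with t _
        exact hc t
    _ = C ^ 2 * ∑ t, ‖x t‖ ^ 2 := by rw [← Finset.mul_sum]; ring

theorem sum_fin_le {n : ℕ} {u : ℤ → ℝ} (hu : Summable u) (h0 : ∀ k, 0 ≤ u k) (e : Fin n → ℤ)
    (he : Function.Injective e) : ∑ t, u (e t) ≤ ∑' k, u k := by
  rw [← Finset.sum_image (f := u) (g := e) (s := Finset.univ) (fun _ _ _ _ h => he h)]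
  exact hu.sum_le_tsum _ (fun _ _ => h0 _)

theorem Toep_norm_le (n : ℕ) {a : ℤ → ℂ} (ha : Summable fun k => ‖a k‖) :
    ‖Toep n a‖ ≤ ∑' k, ‖a k‖ := by
  refine schur _ _ (tsum_nonneg fun _ => norm_nonneg _) (fun s => ?_) (fun t => ?_)
  · exact sum_fin_le ha (fun _ => norm_nonneg _) (fun t : Fin n => (s : ℤ) - (t : ℤ))
      (fun i j h => by simp only at h; ext; omega)
  · exact sum_fin_le ha (fun _ => norm_nonneg _) (fun s : Fin n => (s : ℤ) - (t : ℤ))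
      (fun i j h => by simp only at h; ext; omega)

/-- Indicator of the complement of `[0,n)`. -/
def chi (n : ℕ) (j : ℤ) : ℝ := if 0 ≤ j ∧ j < n then 0 else 1

theorem chi_nonneg (n j) : 0 ≤ chi n j := by unfold chi; split_ifs <;> norm_num
theorem chi_le (n j) : chi n j ≤ 1 := by unfold chi; split_ifs <;> norm_num

theorem sum_chi (n : ℕ) (m : ℤ) : ∑ s : Fin n, chi n ((s : ℤ) - m) ≤ |(m : ℝ)| := by
  have h1 : ∑ s : Fin n, chi n ((s : ℤ) - m) =
      ((Finset.univ.filter fun s : Fin n => ¬ (0 ≤ (s : ℤ) - m ∧ (s : ℤ) - m < n)).card : ℝ) := by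
    rw [Finset.card_filter]
    push_cast
    refine Finset.sum_congr rfl fun s _ => ?_
    unfold chi
    split_ifs <;> simp_all
  rw [h1]
  have h2 : (Finset.univ.filter fun s : Fin n => ¬ (0 ≤ (s : ℤ) - m ∧ (s : ℤ) - m < n)).card
      ≤ m.natAbs := by
    rcases le_total 0 m with hm | hm
    · calc _ ≤ (Finset.range m.natAbs).card := by
            refine Finset.card_le_card_of_injOn (fun s => (s : ℕ)) ?_ ?_
            · intro s hs
              simp at hs ⊢
              have := s.2
              omega
            · intro i _ j _ h
              exact Fin.ext h
        _ = _ := by simp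
    · calc _ ≤ (Finset.range m.natAbs).card := by
            refine Finset.card_le_card_of_injOn (fun s => n - 1 - (s : ℕ)) ?_ ?_
            · intro s hs
              simp at hs ⊢
              have := s.2
              omega
            · intro i _ j _ h
              have := i.2
              have := j.2
              simp only at h
              ext; omega
        _ = _ := by simp
  have h3 : |(m : ℝ)| = (m.natAbs : ℝ) := by
    rw [Nat.cast_natAbs]; simp
  rw [h3]
  exact_mod_cast h2

theorem Toep_mul_entry (n : ℕ) {a b : ℤ → ℂ} (ha : Summable fun k => ‖a k‖)
    (hb : Summable fun k => ‖b k‖) (s t : Fin n) :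
    ‖(Toep n a * Toep n b - Toep n (cv a b)) s t‖ ≤
      ∑' j : ℤ, chi n j * ‖a (s - j)‖ * ‖b (j - t)‖ := by
  have hsab : Summable fun j : ℤ => ‖a (s - j) * b (j - t)‖ := by
    have h := (summable_shear ha hb (fun _ => norm_nonneg _) (fun _ => norm_nonneg _)).prod_factor
      ((s : ℤ) - t)
    rw [← (Equiv.subRight (t : ℤ)).summable_iff] at h
    refine h.congr fun j => ?_
    simp
  have h1 : cv a b ((s : ℤ) - t) = ∑' j : ℤ, a (s - j) * b (j - t) := by
    unfold cv
    rw [← (Equiv.subRight (t : ℤ)).tsum_eq]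
    refine tsum_congr fun j => ?_
    simp
  have h2 : (Toep n a * Toep n b) s t = ∑' j : ℤ, (1 - chi n j : ℝ) * (a (s - j) * b (j - t)) := by
    rw [Matrix.mul_apply]
    let e : Fin n ↪ ℤ := ⟨fun j => (j : ℤ), fun i j h => by simp only at h; ext; omega⟩
    have hej : ∀ j : Fin n, e j = (j : ℤ) := fun _ => rfl
    rw [tsum_eq_sum (s := Finset.univ.map e)]
    · rw [Finset.sum_map]
      refine Finset.sum_congr rfl fun j _ => ?_
      have : chi n (e j) = 0 := by
        unfold chi
        rw [if_pos]
        simp [hej]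
      rw [this]
      simp [Toep, hej]
    · intro j hj
      have : chi n j = 1 := by
        unfold chi
        rw [if_neg]
        rintro ⟨h1, h2⟩
        apply hj
        simp only [Finset.mem_map, Finset.mem_univ, true_and]
        exact ⟨⟨j.toNat, by omega⟩, by rw [hej]; simp [h1]⟩
      rw [this]; simp
  have hs1 : Summable fun j : ℤ => ((1 - chi n j : ℝ) : ℂ) * (a (s - j) * b (j - t)) := by
    refine Summable.of_norm_bounded hsab fun j => ?_
    rw [norm_mul, Complex.norm_real, Real.norm_eq_abs, abs_of_nonneg (by linarith [chi_le n j])]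
    exact mul_le_of_le_one_left (norm_nonneg _) (by linarith [chi_nonneg n j])
  have h3 : (Toep n a * Toep n b - Toep n (cv a b)) s t =
      - ∑' j : ℤ, ((chi n j : ℝ) : ℂ) * (a (s - j) * b (j - t)) := by
    rw [Matrix.sub_apply, h2]
    change _ - cv a b ((s : ℤ) - t) = _
    rw [h1, ← hs1.tsum_sub hsab.of_norm, ← tsum_neg]
    refine tsum_congr fun j => ?_
    push_cast
    ring
  rw [h3, norm_neg]
  have h4 : ∀ j : ℤ, ‖((chi n j : ℝ) : ℂ) * (a (s - j) * b (j - t))‖ =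
      chi n j * ‖a (s - j)‖ * ‖b (j - t)‖ := by
    intro j
    rw [norm_mul, norm_mul, Complex.norm_real, Real.norm_eq_abs, abs_of_nonneg (chi_nonneg n j)]
    ring
  simp_rw [← h4]
  refine norm_tsum_le_tsum_norm ?_
  refine Summable.of_nonneg_of_le (fun _ => norm_nonneg _) (fun j => ?_) hsab
  rw [norm_mul, Complex.norm_real, Real.norm_eq_abs, abs_of_nonneg (chi_nonneg n j)]
  exact mul_le_of_le_one_left (norm_nonneg _) (chi_le n j)

theorem Toep_mul_sum (n : ℕ) {a b : ℤ → ℂ} (ha : Summable fun k => ‖a k‖)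
    (ha' : Summable fun k : ℤ => |(k : ℝ)| * ‖a k‖)
    (hb : Summable fun k => ‖b k‖) :
    ∑ s, ∑ t, ‖(Toep n a * Toep n b - Toep n (cv a b)) s t‖ ≤
      (∑' k, ‖b k‖) * ∑' k : ℤ, |(k : ℝ)| * ‖a k‖ := by
  set Bn := ∑' k, ‖b k‖ with hBn
  have hBn0 : 0 ≤ Bn := tsum_nonneg fun _ => norm_nonneg _
  have hbb : ∀ k, ‖b k‖ ≤ Bn := fun k => hb.le_tsum k (fun _ _ => norm_nonneg _)
  have hsa : ∀ s : Fin n, Summable fun j : ℤ => chi n j * ‖a (s - j)‖ := by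
    intro s
    have : Summable fun j : ℤ => ‖a (s - j)‖ :=
      ((Equiv.subLeft (s : ℤ)).summable_iff (f := fun k => ‖a k‖)).mpr ha
    refine Summable.of_nonneg_of_le (fun j => mul_nonneg (chi_nonneg n j) (norm_nonneg _))
      (fun j => ?_) this
    exact mul_le_of_le_one_left (norm_nonneg _) (chi_le n j)
  have hrow : ∀ s : Fin n, ∑ t, ‖(Toep n a * Toep n b - Toep n (cv a b)) s t‖ ≤
      Bn * ∑' m : ℤ, chi n (s - m) * ‖a m‖ := by
    intro s
    have hst : ∀ t : Fin n, Summable fun j : ℤ => chi n j * ‖a (s - j)‖ * ‖b (j - t)‖ := by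
      intro t
      refine Summable.of_nonneg_of_le (fun j => by have := chi_nonneg n j; positivity) (fun j => ?_)
        ((hsa s).mul_right Bn)
      have := chi_nonneg n j
      gcongr
      exact hbb _
    calc _ ≤ ∑ t : Fin n, ∑' j : ℤ, chi n j * ‖a (s - j)‖ * ‖b (j - t)‖ :=
          Finset.sum_le_sum fun t _ => Toep_mul_entry n ha hb s t
      _ = ∑' j : ℤ, ∑ t : Fin n, chi n j * ‖a (s - j)‖ * ‖b (j - t)‖ :=
          (Summable.tsum_finsetSum fun t _ => hst t).symm
      _ ≤ ∑' j : ℤ, Bn * (chi n j * ‖a (s - j)‖) := by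
          refine Summable.tsum_le_tsum (fun j => ?_) (summable_sum fun t _ => hst t) ((hsa s).mul_left Bn)
          rw [← Finset.mul_sum, mul_comm]
          have := chi_nonneg n j
          gcongr
          exact sum_fin_le hb (fun _ => norm_nonneg _) (fun t : Fin n => j - (t : ℤ))
            (fun i j h => by simp only at h; ext; omega)
      _ = Bn * ∑' j : ℤ, chi n j * ‖a (s - j)‖ := tsum_mul_left
      _ = _ := by
          congr 1
          rw [← (Equiv.subLeft (s : ℤ)).tsum_eq]
          refine tsum_congr fun j => ?_
          simp
  calc _ ≤ ∑ s : Fin n, Bn * ∑' m : ℤ, chi n (s - m) * ‖a m‖ := Finset.sum_le_sum fun s _ => hrow s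
    _ = Bn * ∑ s : Fin n, ∑' m : ℤ, chi n (s - m) * ‖a m‖ := by rw [Finset.mul_sum]
    _ ≤ _ := by
      gcongr
      have hs2 : ∀ s : Fin n, Summable fun m : ℤ => chi n (s - m) * ‖a m‖ := by
        intro s
        refine Summable.of_nonneg_of_le (fun j => mul_nonneg (chi_nonneg n _) (norm_nonneg _))
          (fun j => ?_) ha
        exact mul_le_of_le_one_left (norm_nonneg _) (chi_le n _)
      rw [← Summable.tsum_finsetSum fun s _ => hs2 s]
      refine Summable.tsum_le_tsum (fun m => ?_) (summable_sum fun s _ => hs2 s) ha'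
      rw [← Finset.sum_mul]
      gcongr
      exact sum_chi n m

/-- The matrices `M n` approximate, in trace norm, the Toeplitz matrices of `h`. -/
def Appr (M : (n : ℕ) → Matrix (Fin n) (Fin n) ℂ) (h : ℝ → ℂ) : Prop :=
  ∃ a, FRep a h ∧ (∃ K, ∀ n, ‖M n‖ ≤ K) ∧
    ∃ C, ∀ n (X : Matrix (Fin n) (Fin n) ℂ), ‖((M n - Toep n a) * X).trace‖ ≤ C * ‖X‖

theorem Toep_mul_appr {a b h k} (ha : FRep a h) (hb : FRep b k) :
    ∃ C, 0 ≤ C ∧ ∀ n (X : Matrix (Fin n) (Fin n) ℂ),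
      ‖((Toep n a * Toep n b - Toep n (cv a b)) * X).trace‖ ≤ C * ‖X‖ := by
  refine ⟨(∑' k, ‖b k‖) * ∑' k : ℤ, |(k : ℝ)| * ‖a k‖,
    mul_nonneg (tsum_nonneg fun _ => by positivity) (tsum_nonneg fun _ => by positivity), fun n X => ?_⟩
  refine (trace_mul_le _ _).trans ?_
  gcongr
  exact Toep_mul_sum n (summable_of_w ha.1) (summable_of_w' ha.1) (summable_of_w hb.1)

theorem Appr.mul {M N h k} (hM : Appr M h) (hN : Appr N k) :
    Appr (fun n => M n * N n) (fun x => h x * k x) := by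
  obtain ⟨a, ha, ⟨K1, hK1⟩, C1, hC1⟩ := hM
  obtain ⟨b, hb, ⟨K2, hK2⟩, C2, hC2⟩ := hN
  have hK10 : 0 ≤ K1 := (norm_nonneg _).trans (hK1 0)
  have hK20 : 0 ≤ K2 := (norm_nonneg _).trans (hK2 0)
  obtain ⟨C3, hC30, hC3⟩ := Toep_mul_appr ha hb
  refine ⟨cv a b, ha.mul hb, ⟨K1 * K2, fun n => ?_⟩, |C1| * K2 + |C2| * (∑' k, ‖a k‖) + C3, fun n X => ?_⟩
  · refine (norm_mul_le _ _).trans ?_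
    gcongr
    · exact hK1 n
    · exact hK2 n
  · have h1 : ‖((M n - Toep n a) * (N n * X)).trace‖ ≤ |C1| * K2 * ‖X‖ := by
      refine (hC1 n _).trans ?_
      calc C1 * ‖N n * X‖ ≤ |C1| * (K2 * ‖X‖) := by
            gcongr
            · exact le_abs_self _
            · refine (norm_mul_le _ _).trans ?_
              gcongr
              exact hK2 n
        _ = _ := by ring
    have h2 : ‖((N n - Toep n b) * (X * Toep n a)).trace‖ ≤ |C2| * (∑' k, ‖a k‖) * ‖X‖ := by
      refine (hC2 n _).trans ?_
      calc C2 * ‖X * Toep n a‖ ≤ |C2| * (‖X‖ * ∑' k, ‖a k‖) := by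
            gcongr
            · exact le_abs_self _
            · refine (norm_mul_le _ _).trans ?_
              gcongr
              exact Toep_norm_le n (summable_of_w ha.1)
        _ = _ := by ring
    have h3 := hC3 n X
    have h4 : ((M n * N n - Toep n (cv a b)) * X).trace =
        ((M n - Toep n a) * (N n * X)).trace + ((N n - Toep n b) * (X * Toep n a)).trace +
          ((Toep n a * Toep n b - Toep n (cv a b)) * X).trace := by
      have : ((N n - Toep n b) * (X * Toep n a)).trace = (Toep n a * (N n - Toep n b) * X).trace := by
        rw [← Matrix.mul_assoc, Matrix.trace_mul_comm, Matrix.mul_assoc]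
      rw [this, ← Matrix.trace_add, ← Matrix.trace_add]
      congr 1
      noncomm_ring
    rw [h4]
    refine (norm_add₃_le).trans ?_
    rw [add_mul, add_mul]
    linarith

theorem Toep_dl (n : ℕ) : Toep n dl = 1 := by
  ext s t
  simp only [Toep, dl, Matrix.one_apply]
  refine if_congr ?_ rfl rfl
  rw [Fin.ext_iff]
  omega

theorem Appr.one : Appr (fun _ => 1) (fun _ => 1) :=
  ⟨dl, FRep.one, ⟨1, fun _ => norm_one_le⟩, 0, fun n X => by simp [Toep_dl]⟩

theorem Appr.prod {ν : ℕ} (M : Fin ν → (n : ℕ) → Matrix (Fin n) (Fin n) ℂ) (h : Fin ν → ℝ → ℂ)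
    (H : ∀ i, Appr (M i) (h i)) :
    Appr (fun n => (List.ofFn (fun i => M i n)).prod) (fun x => ∏ i, h i x) := by
  induction ν with
  | zero => simpa using Appr.one
  | succ ν ih =>
    simp only [List.ofFn_succ, List.prod_cons, Fin.prod_univ_succ]
    exact (H 0).mul (ih _ _ fun i => H i.succ)

theorem Appr.trace {M h} (H : Appr M h) :
    ∃ C, ∀ n : ℕ, ‖(M n).trace - n * ((2 * π : ℂ)⁻¹ * ∫ x in Ioc (-π) π, h x)‖ ≤ C := by
  obtain ⟨a, ha, -, C, hC⟩ := H
  refine ⟨|C|, fun n => ?_⟩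
  have h0 : (2 * π : ℂ) ≠ 0 := by simp [pi_ne_zero]
  rw [ha.coeff_zero, inv_mul_cancel_left₀ h0]
  have h1 := hC n 1
  have h2 : (Toep n a).trace = n * a 0 := by simp [Matrix.trace, Toep]
  rw [mul_one, Matrix.trace_sub, h2] at h1
  refine h1.trans ?_
  calc C * ‖(1 : Matrix (Fin n) (Fin n) ℂ)‖ ≤ |C| * 1 := by
        gcongr
        · exact le_abs_self C
        · exact norm_one_le
    _ = _ := mul_one _

theorem Appr.of_memF1T {g : ℝ → ℝ} (hg : memF1T g) : Appr (fun n => BT n g) (fun x => 2 * π * g x) := by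
  have hr := FRep.of_memF1T hg
  refine ⟨fcT g, hr, ⟨_, fun n => Toep_norm_le n (summable_of_w hr.1)⟩, 0, fun n X => ?_⟩
  have : BT n g = Toep n (fcT g) := rfl
  simp [this]

theorem quad_nonneg (n : ℕ) (h : ℝ → ℝ) (hi : IntegrableOn h (Ioc (-π) π))
    (h0 : ∀ x ∈ Ioc (-π) π, 0 ≤ h x) (v : Fin n → ℂ) :
    0 ≤ (star v ⬝ᵥ (BT n h).mulVec v).re := by
  let P : ℝ → ℂ := fun x => ∑ t : Fin n, v t * Complex.exp (-(Complex.I * x * ((t : ℤ) : ℂ)))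
  have hPc : ∀ x, (starRingEnd ℂ) (P x) =
      ∑ s : Fin n, star (v s) * Complex.exp (Complex.I * x * ((s : ℤ) : ℂ)) := by
    intro x
    simp only [P, map_sum, map_mul, ← Complex.exp_conj]
    refine Finset.sum_congr rfl fun s _ => ?_
    simp
  have key : star v ⬝ᵥ (BT n h).mulVec v = ((∫ x in Ioc (-π) π, Complex.normSq (P x) * h x : ℝ) : ℂ) := by
    rw [← integral_complex_ofReal]
    have e1 : ∀ x : ℝ, ((Complex.normSq (P x) * h x : ℝ) : ℂ) = ∑ s : Fin n, ∑ t : Fin n,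
        star (v s) * v t * (Complex.exp (Complex.I * x * (((s : ℤ) - (t : ℤ) : ℤ) : ℂ)) * h x) := by
      intro x
      rw [Complex.ofReal_mul, Complex.normSq_eq_conj_mul_self, hPc]
      simp only [P]
      rw [Finset.sum_mul_sum, Finset.sum_mul]
      refine Finset.sum_congr rfl fun s _ => ?_
      rw [Finset.sum_mul]
      refine Finset.sum_congr rfl fun t _ => ?_
      have : Complex.exp (Complex.I * x * (((s : ℤ) - (t : ℤ) : ℤ) : ℂ)) =
          Complex.exp (Complex.I * x * ((s : ℤ) : ℂ)) * Complex.exp (-(Complex.I * x * ((t : ℤ) : ℂ))) := by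
        rw [← Complex.exp_add]; congr 1; push_cast; ring
      rw [this]; ring
    have hint : ∀ k : ℤ, Integrable (fun x : ℝ => Complex.exp (Complex.I * x * k) * (h x : ℂ))
        (volume.restrict (Ioc (-π) π)) := by
      intro k
      refine Integrable.bdd_mul (c := 1) hi.ofReal ?_ ?_
      · exact Continuous.aestronglyMeasurable (by fun_prop)
      · exact ae_of_all _ (fun x => (norm_exp_I' x k).le)
    simp_rw [e1]
    rw [integral_finsetSum _ fun s _ => integrable_finsetSum _ fun t _ => (hint _).const_mul _]
    simp only [dotProduct, Matrix.mulVec, Pi.star_apply]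
    refine Finset.sum_congr rfl fun s _ => ?_
    rw [integral_finsetSum _ fun t _ => (hint _).const_mul _, Finset.mul_sum]
    refine Finset.sum_congr rfl fun t _ => ?_
    rw [integral_const_mul]
    simp only [BT, fcT]
    ring
  rw [key, Complex.ofReal_re]
  exact setIntegral_nonneg measurableSet_Ioc fun x hx => mul_nonneg (Complex.normSq_nonneg _) (h0 x hx)

theorem BT_split (n : ℕ) (h : ℝ → ℝ) (hi : IntegrableOn h (Ioc (-π) π)) (m : ℝ) :
    BT n h = BT n (fun x => h x - m) + ((2 * π * m : ℝ) : ℂ) • (1 : Matrix (Fin n) (Fin n) ℂ) := by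
  ext s t
  simp only [BT, Matrix.add_apply, Matrix.smul_apply, Matrix.one_apply]
  generalize hk : (s : ℤ) - (t : ℤ) = k
  have hst : (s = t) ↔ k = 0 := by rw [Fin.ext_iff]; omega
  have hint : ∀ u : ℝ → ℝ, IntegrableOn u (Ioc (-π) π) →
      Integrable (fun x : ℝ => Complex.exp (Complex.I * x * k) * (u x : ℂ))
      (volume.restrict (Ioc (-π) π)) := by
    intro u hu
    refine Integrable.bdd_mul (c := 1) hu.ofReal ?_ ?_
    · exact Continuous.aestronglyMeasurable (by fun_prop)
    · exact ae_of_all _ (fun x => (norm_exp_I' x k).le)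
  have hm : IntegrableOn (fun _ : ℝ => m) (Ioc (-π) π) := by simp
  unfold fcT
  simp_rw [Complex.ofReal_sub, mul_sub]
  rw [integral_sub (hint h hi) (hint _ hm), integral_mul_const, integral_exp_int]
  simp only [hst]
  split_ifs <;> simp

theorem BT_lower {f : ℝ → ℝ} (hf : memF2T f) : ∃ c > 0, ∀ n (x : EuclideanSpace ℂ (Fin n)),
    c * ‖x‖ ≤ ‖WithLp.toLp 2 ((BT n f).mulVec x.ofLp)‖ := by
  obtain ⟨m, hm, hmf⟩ := hf.lower
  refine ⟨2 * π * m, by positivity, fun n x => ?_⟩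
  have hi := hf.memF1T.1
  have h1 := quad_nonneg n (fun y => f y - m) (hi.sub (by simp))
    (fun y hy => by linarith [hmf y (Ioc_subset_Icc_self hy)]) x.ofLp
  have h2 : (star x.ofLp ⬝ᵥ (BT n f).mulVec x.ofLp).re =
      (star x.ofLp ⬝ᵥ (BT n (fun y => f y - m)).mulVec x.ofLp).re + 2 * π * m * ‖x‖ ^ 2 := by
    rw [BT_split n f hi m, Matrix.add_mulVec, dotProduct_add, Complex.add_re, Matrix.smul_mulVec,
      Matrix.one_mulVec, dotProduct_smul, smul_eq_mul, Complex.re_ofReal_mul]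
    congr 2
    rw [EuclideanSpace.norm_sq_eq]
    simp only [dotProduct, Pi.star_apply, Complex.re_sum]
    refine Finset.sum_congr rfl fun i _ => ?_
    have : star (x.ofLp i) * x.ofLp i = (Complex.normSq (x.ofLp i) : ℂ) := by
      rw [Complex.normSq_eq_conj_mul_self]; rfl
    rw [this, Complex.ofReal_re, Complex.normSq_eq_norm_sq]
  have h3 : (star x.ofLp ⬝ᵥ (BT n f).mulVec x.ofLp).re ≤
      ‖x‖ * ‖WithLp.toLp 2 ((BT n f).mulVec x.ofLp)‖ := by
    have h4 := norm_inner_le_norm (𝕜 := ℂ) x (WithLp.toLp 2 ((BT n f).mulVec x.ofLp))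
    refine (Complex.re_le_norm _).trans (le_trans (le_of_eq ?_) h4)
    rw [EuclideanSpace.inner_eq_star_dotProduct, dotProduct_comm]
  rcases (norm_nonneg x).eq_or_lt with hx | hx
  · rw [← hx, mul_zero]; positivity
  · refine le_of_mul_le_mul_left ?_ hx
    nlinarith

theorem BT_isUnit {f : ℝ → ℝ} (hf : memF2T f) (n : ℕ) : IsUnit (BT n f) := by
  obtain ⟨c, hc, hl⟩ := BT_lower hf
  rw [← Matrix.mulVec_injective_iff_isUnit]
  intro u v huv
  have h1 := hl n (WithLp.toLp 2 (u - v))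
  have h2 : (BT n f).mulVec (u - v) = 0 := by
    rw [Matrix.mulVec_sub, sub_eq_zero]; exact huv
  simp only [h2] at h1
  have h3 : ‖WithLp.toLp 2 (u - v)‖ ≤ 0 := by
    have h5 : c * ‖WithLp.toLp 2 (u - v)‖ ≤ 0 := by simpa using h1
    exact nonpos_of_mul_nonpos_right h5 hc
  have h4 := norm_le_zero_iff.mp h3
  have h6 : u - v = 0 := congrArg WithLp.ofLp h4
  exact sub_eq_zero.mp h6

theorem BT_inv_bdd {f : ℝ → ℝ} (hf : memF2T f) : ∃ K, ∀ n, ‖(BT n f)⁻¹‖ ≤ K := by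
  obtain ⟨c, hc, hl⟩ := BT_lower hf
  refine ⟨c⁻¹, fun n => opNorm_le_of _ _ (by positivity) fun x => ?_⟩
  have h1 := hl n (WithLp.toLp 2 ((BT n f)⁻¹.mulVec x.ofLp))
  have hu := (Matrix.isUnit_iff_isUnit_det _).mp (BT_isUnit hf n)
  simp only [Matrix.mulVec_mulVec, Matrix.mul_nonsing_inv _ hu, Matrix.one_mulVec] at h1
  rw [inv_mul_eq_div, le_div_iff₀ hc, mul_comm]
  exact h1

theorem Appr.inv {f : ℝ → ℝ} (hf : memF2T f) :
    Appr (fun n => (BT n f)⁻¹) (fun x => (2 * π * f x : ℂ)⁻¹) := by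
  obtain ⟨K, hK⟩ := BT_inv_bdd hf
  have hK0 : 0 ≤ K := (norm_nonneg _).trans (hK 0)
  have hp : (π : ℂ) ≠ 0 := by simp [pi_ne_zero]
  have hrf := FRep.of_memF1T hf.memF1T
  have hri : FRep (fun k => ((2 * π : ℂ)⁻¹) ^ 2 * fcT (fun x => (f x)⁻¹) k)
      (fun x => (2 * π * f x : ℂ)⁻¹) := by
    have := (FRep.of_memF1T hf.inv.memF1T).smul (((2 * π : ℂ)⁻¹) ^ 2)
    convert this using 2 with x
    have h0 : (f x : ℂ) ≠ 0 := by exact_mod_cast (hf.pos x).ne'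
    push_cast
    field_simp
  set c : ℤ → ℂ := fun k => ((2 * π : ℂ)⁻¹) ^ 2 * fcT (fun x => (f x)⁻¹) k with hc
  have hcv : cv (fcT f) c = dl := by
    refine (hrf.mul hri).unique FRep.one (ae_of_all _ fun x => ?_)
    have h0 : (f x : ℂ) ≠ 0 := by exact_mod_cast (hf.pos x).ne'
    rw [mul_inv_cancel₀]
    exact mul_ne_zero (mul_ne_zero two_ne_zero hp) h0
  obtain ⟨C, hC0, hC⟩ := Toep_mul_appr hrf hri
  refine ⟨c, hri, ⟨K, hK⟩, C * K, fun n X => ?_⟩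
  have hu := (Matrix.isUnit_iff_isUnit_det _).mp (BT_isUnit hf n)
  have hB : Toep n (fcT f) = BT n f := rfl
  have h1 := hC n (X * (BT n f)⁻¹)
  rw [hcv, Toep_dl, hB] at h1
  have h2 : (((BT n f)⁻¹ - Toep n c) * X).trace =
      -((BT n f * Toep n c - 1) * (X * (BT n f)⁻¹)).trace := by
    rw [← Matrix.mul_assoc, Matrix.trace_mul_comm _ (BT n f)⁻¹, ← Matrix.mul_assoc, Matrix.mul_sub,
      ← Matrix.mul_assoc, Matrix.nonsing_inv_mul _ hu, Matrix.one_mul, Matrix.mul_one, ← Matrix.trace_neg,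
      ← Matrix.neg_mul, neg_sub]
  simp only
  rw [h2, norm_neg]
  refine h1.trans ?_
  rw [mul_assoc]
  gcongr
  refine (norm_mul_le _ _).trans ?_
  rw [mul_comm]
  gcongr
  exact hK n

end mats

theorem stmt8 (ν : ℕ) (hν : 0 < ν) (f g : Fin ν → ℝ → ℝ)
    (hfeven : ∀ i, ∀ x : ℝ, f i (-x) = f i x)
    (hgeven : ∀ i, ∀ x : ℝ, g i (-x) = g i x)
    (hfper : ∀ i, Function.Periodic (f i) (2 * π))
    (hgper : ∀ i, Function.Periodic (g i) (2 * π))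
    (hf : ∀ i, memF2T (f i)) (hg : ∀ i, memF1T (g i)) :
    (∀ n : ℕ, ∀ i, IsUnit (BT n (f i))) ∧
    (fun n : ℕ =>
      ‖(n : ℂ)⁻¹ *
          Matrix.trace ((List.ofFn (fun i : Fin ν => (BT n (f i))⁻¹ * BT n (g i))).prod)
        - (((1 / (2 * π)) * ∫ x in Ioc (-π) π, ∏ i, g i x / f i x : ℝ) : ℂ)‖)
      =O[atTop] fun n : ℕ => (n : ℝ)⁻¹ := by
  refine ⟨fun n i => BT_isUnit (hf i) n, ?_⟩
  have H := Appr.prod (fun i n => (BT n (f i))⁻¹ * BT n (g i)) _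
    (fun i => (Appr.inv (hf i)).mul (Appr.of_memF1T (hg i)))
  obtain ⟨C, hC⟩ := H.trace
  have hI : (((1 / (2 * π)) * ∫ x in Ioc (-π) π, ∏ i, g i x / f i x : ℝ) : ℂ) =
      (2 * π : ℂ)⁻¹ * ∫ x in Ioc (-π) π, ∏ i, (2 * π * f i x : ℂ)⁻¹ * (2 * π * g i x) := by
    rw [Complex.ofReal_mul, ← integral_complex_ofReal]
    congr 1
    · push_cast; rw [one_div]
    · refine integral_congr_ae (ae_of_all _ fun x => ?_)
      simp only
      rw [Complex.ofReal_prod]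
      refine Finset.prod_congr rfl fun i _ => ?_
      have hp : (π : ℂ) ≠ 0 := by simp [pi_ne_zero]
      have h0 : (f i x : ℂ) ≠ 0 := by exact_mod_cast ((hf i).pos x).ne'
      push_cast
      field_simp
  rw [hI]
  refine IsBigO.of_bound C ?_
  filter_upwards [eventually_gt_atTop 0] with n hn
  have hn' : (n : ℂ) ≠ 0 := by exact_mod_cast hn.ne'
  have h1 := hC n
  rw [norm_norm, norm_inv, Real.norm_natCast]
  set I := (2 * π : ℂ)⁻¹ * ∫ x in Ioc (-π) π, ∏ i, (2 * π * f i x : ℂ)⁻¹ * (2 * π * g i x)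
  set tr := Matrix.trace ((List.ofFn (fun i : Fin ν => (BT n (f i))⁻¹ * BT n (g i))).prod)
  have h2 : (n : ℂ)⁻¹ * tr - I = (n : ℂ)⁻¹ * (tr - n * I) := by
    field_simp
  rw [h2, norm_mul, norm_inv, Complex.norm_natCast, mul_comm]
  gcongr
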